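/- Smoothing a q-tame module yields a locally finite module: let V be a q-tame persistence module over ℝ and let ε > 0. Then the ε-smoothing V^ε is locally finite; in particular, V^ε is isomorphic to a direct sum of interval modules. -/

import Mathlib

attribute [local instance] Classical.propDecidable

structure PersMod (k : Type) [Field k] (T : Type) [Preorder T] where
  space : T → Type
  [addCommGroup : ∀ t, AddCommGroup (space t)]
  [module : ∀ t, Module k (space t)]
  map : ∀ s t : T, s ≤ t → space s →ₗ[k] space t
  map_id : ∀ t, map t t le_rfl = LinearMap.id
  map_comp : ∀ r s t (h1 : r ≤ s) (h2 : s ≤ t),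
    (map s t h2).comp (map r s h1) = map r t (h1.trans h2)

attribute [instance] PersMod.addCommGroup PersMod.module

def PersIso {k : Type} [Field k] {T : Type} [Preorder T] (U V : PersMod k T) : Prop :=
  ∃ e : ∀ t, U.space t ≃ₗ[k] V.space t,
    ∀ s t (h : s ≤ t),
      (e t).toLinearMap.comp (U.map s t h) = (V.map s t h).comp (e s).toLinearMap

def IsIntervalSet {T : Type} [Preorder T] (J : Set T) : Prop :=
  J.Nonempty ∧ ∀ ⦃r s t : T⦄, r ∈ J → t ∈ J → r ≤ s → s ≤ t → s ∈ J

noncomputable def intervalModule (k : Type) [Field k] (T : Type) [Preorder T]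
    (J : Set T) (hJ : IsIntervalSet J) : PersMod k T where
  space t := PLift (t ∈ J) → k
  addCommGroup := fun _ => inferInstance
  module := fun _ => inferInstance
  map s t _ :=
    { toFun := fun f _ => if hs : s ∈ J then f ⟨hs⟩ else 0
      map_add' := fun f g => by
        funext ht; by_cases hs : s ∈ J <;> simp [hs]
      map_smul' := fun c f => by
        funext ht; by_cases hs : s ∈ J <;> simp [hs] }
  map_id t := by
    refine LinearMap.ext fun f => funext fun ht => ?_
    show (if hs : t ∈ J then f ⟨hs⟩ else 0) = f ht
    rw [dif_pos ht.down]
  map_comp r s t h1 h2 := by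
    refine LinearMap.ext fun f => funext fun ht => ?_
    show (if hs : s ∈ J then (if hr : r ∈ J then f ⟨hr⟩ else 0) else 0)
        = (if hr : r ∈ J then f ⟨hr⟩ else 0)
    by_cases hr : r ∈ J
    · have hs : s ∈ J := hJ.2 hr ht.down h1 h2
      simp [hr, hs]
    · by_cases hs : s ∈ J <;> simp [hr, hs]

noncomputable def dsum {k : Type} [Field k] {T : Type} [Preorder T] {L : Type}
    (V : L → PersMod k T) : PersMod k T where
  space t := DFinsupp (fun ℓ => (V ℓ).space t)
  addCommGroup := fun _ => inferInstance
  module := fun _ => inferInstance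
  map s t h := DFinsupp.mapRange.linearMap (fun ℓ => (V ℓ).map s t h)
  map_id t := by
    show DFinsupp.mapRange.linearMap (fun ℓ => (V ℓ).map t t le_rfl) = LinearMap.id
    have : (fun ℓ => (V ℓ).map t t le_rfl)
        = fun ℓ => (LinearMap.id : (V ℓ).space t →ₗ[k] (V ℓ).space t) :=
      funext fun ℓ => (V ℓ).map_id t
    rw [this]
    exact DFinsupp.mapRange.linearMap_id
  map_comp r s t h1 h2 := by
    show (DFinsupp.mapRange.linearMap (fun ℓ => (V ℓ).map s t h2)).comp
        (DFinsupp.mapRange.linearMap (fun ℓ => (V ℓ).map r s h1))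
      = DFinsupp.mapRange.linearMap (fun ℓ => (V ℓ).map r t (h1.trans h2))
    rw [← DFinsupp.mapRange.linearMap_comp]
    congr 1
    funext ℓ
    exact (V ℓ).map_comp r s t h1 h2

open scoped ENNReal

section Dim

noncomputable def edim (k : Type) [Field k] (M : Type) [AddCommGroup M] [Module k M] : ℕ∞ :=
  Cardinal.toENat (Module.rank k M)

noncomputable def erank {k : Type} [Field k] {M N : Type} [AddCommGroup M] [Module k M]
    [AddCommGroup N] [Module k N] (f : M →ₗ[k] N) : ℕ∞ :=
  edim k (LinearMap.range f)

noncomputable def ecard (S : Type) : ℕ∞ := Cardinal.toENat (Cardinal.mk S)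

end Dim

section Matchings

noncomputable def eDiff (x y : EReal) : ℝ≥0∞ :=
  if x = y then 0
  else if x = ⊤ ∨ x = ⊥ ∨ y = ⊤ ∨ y = ⊥ then ⊤
  else ENNReal.ofReal |x.toReal - y.toReal|

noncomputable def dPt (α β : EReal × EReal) : ℝ≥0∞ :=
  max (eDiff α.1 β.1) (eDiff α.2 β.2)

noncomputable def diagDist (α : EReal × EReal) : ℝ≥0∞ :=
  if α.1 = ⊥ ∨ α.2 = ⊤ then ⊤ else ENNReal.ofReal ((α.2.toReal - α.1.toReal) / 2)

def IsMatching {α β : Type} (M : Set (α × β)) : Prop :=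
  (∀ a b b', (a, b) ∈ M → (a, b') ∈ M → b = b') ∧
  (∀ a a' b, (a, b) ∈ M → (a', b) ∈ M → a = a')

def IsDeltaMatching {α β : Type} (A : α → EReal × EReal) (B : β → EReal × EReal)
    (δ : ℝ≥0∞) : Prop :=
  ∃ M : Set (α × β), IsMatching M ∧
    (∀ p ∈ M, dPt (A p.1) (B p.2) ≤ δ) ∧
    (∀ a, (∀ b, (a, b) ∉ M) → diagDist (A a) ≤ δ) ∧
    (∀ b, (∀ a, (a, b) ∉ M) → diagDist (B b) ≤ δ)

noncomputable def dBottle {α β : Type} (A : α → EReal × EReal) (B : β → EReal × EReal) : ℝ≥0∞ :=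
  sInf {d : ℝ≥0∞ | ∃ δ : ℝ, 0 ≤ δ ∧ IsDeltaMatching A B (ENNReal.ofReal δ) ∧ d = ENNReal.ofReal δ}

end Matchings

section Measure

noncomputable def persIm {k : Type} [Field k] (V : PersMod k ℝ) (a : EReal) (c : ℝ) :
    Submodule k (V.space c) :=
  if h : ∃ a' : ℝ, a = (a' : EReal) ∧ a' ≤ c then
    LinearMap.range (V.map h.choose c h.choose_spec.2)
  else ⊥

noncomputable def persKer {k : Type} [Field k] (V : PersMod k ℝ) (c : ℝ) (d : EReal) :
    Submodule k (V.space c) :=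
  if h : ∃ d' : ℝ, d = (d' : EReal) ∧ c ≤ d' then
    LinearMap.ker (V.map c h.choose h.choose_spec.2)
  else ⊤

noncomputable def persMeasure {k : Type} [Field k] (V : PersMod k ℝ)
    (a : EReal) (b c : ℝ) (d : EReal) : ℕ∞ :=
  edim k
    (↥(persIm V (b : EReal) c ⊓ persKer V c d) ⧸
      Submodule.comap (persIm V (b : EReal) c ⊓ persKer V c d).subtype
        (persIm V a c ⊓ persKer V c d))

end Measure

section Interleaving

def Interleaved (k : Type) [Field k] (U V : PersMod k ℝ) (δ : ℝ) : Prop :=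
  ∃ (φ : ∀ t : ℝ, U.space t →ₗ[k] V.space (t + δ))
    (ψ : ∀ t : ℝ, V.space t →ₗ[k] U.space (t + δ)),
    (∀ s t (h : s ≤ t),
      (φ t).comp (U.map s t h) = (V.map (s + δ) (t + δ) (by linarith)).comp (φ s)) ∧
    (∀ s t (h : s ≤ t),
      (ψ t).comp (V.map s t h) = (U.map (s + δ) (t + δ) (by linarith)).comp (ψ s)) ∧
    (∀ t (h : t ≤ t + δ + δ), (ψ (t + δ)).comp (φ t) = U.map t (t + δ + δ) h) ∧
    (∀ t (h : t ≤ t + δ + δ), (φ (t + δ)).comp (ψ t) = V.map t (t + δ + δ) h)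

noncomputable def dInter (k : Type) [Field k] (U V : PersMod k ℝ) : ℝ≥0∞ :=
  sInf {d : ℝ≥0∞ | ∃ δ : ℝ, 0 ≤ δ ∧ Interleaved k U V δ ∧ d = ENNReal.ofReal δ}

def QTame (k : Type) [Field k] (V : PersMod k ℝ) : Prop :=
  ∀ s t : ℝ, ∀ h : s < t, erank (V.map s t h.le) ≠ ⊤

def LocFinitePM (k : Type) [Field k] (W : PersMod k ℝ) : Prop :=
  ∃ (L : Type) (J : L → Set ℝ) (hJ : ∀ ℓ, IsIntervalSet (J ℓ)),
    PersIso W (dsum fun ℓ => intervalModule k ℝ (J ℓ) (hJ ℓ)) ∧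
    ∀ S : Set ℝ, Bornology.IsBounded S → {ℓ : L | (J ℓ ∩ S).Nonempty}.Finite

noncomputable def zeroPers (k : Type) [Field k] : PersMod k ℝ where
  space _ := PUnit
  addCommGroup := fun _ => inferInstance
  module := fun _ => inferInstance
  map _ _ _ := 0
  map_id t := LinearMap.ext fun x => Subsingleton.elim _ _
  map_comp r s t h1 h2 := LinearMap.ext fun x => Subsingleton.elim _ _

noncomputable def smoothing {k : Type} [Field k] (V : PersMod k ℝ) (ε : ℝ) (hε : 0 < ε) :
    PersMod k ℝ where
  space t := LinearMap.range (V.map (t - ε) (t + ε) (by linarith))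
  addCommGroup := fun _ => inferInstance
  module := fun _ => inferInstance
  map s t h := LinearMap.restrict (V.map (s + ε) (t + ε) (by linarith))
    (p := LinearMap.range (V.map (s - ε) (s + ε) (by linarith)))
    (q := LinearMap.range (V.map (t - ε) (t + ε) (by linarith)))
    (by
      rintro x ⟨y, rfl⟩
      refine ⟨V.map (s - ε) (t - ε) (by linarith) y, ?_⟩
      have h1 := LinearMap.congr_fun
        (V.map_comp (s - ε) (t - ε) (t + ε) (by linarith) (by linarith)) y
      have h2 := LinearMap.congr_fun
        (V.map_comp (s - ε) (s + ε) (t + ε) (by linarith) (by linarith)) y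
      simp only [LinearMap.comp_apply] at h1 h2
      rw [h1, h2])
  map_id t := by
    refine LinearMap.ext fun x => Subtype.ext ?_
    have := LinearMap.congr_fun (V.map_id (t + ε)) x.1
    simpa [LinearMap.restrict_apply] using this
  map_comp r s t h1 h2 := by
    refine LinearMap.ext fun x => Subtype.ext ?_
    have := LinearMap.congr_fun
      (V.map_comp (r + ε) (s + ε) (t + ε) (by linarith) (by linarith)) x.1
    simpa [LinearMap.restrict_apply] using this

end Interleaving

section Webb

def webbSubmodule (k : Type) [Field k] (t : ℤ) : Submodule k (ℕ → k) where
  carrier := {x | ∀ i : ℕ, (i : ℤ) < -t → x i = 0}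
  add_mem' := by
    intro x y hx hy i hi
    simp [Pi.add_apply, hx i hi, hy i hi]
  zero_mem' := by
    intro i hi
    rfl
  smul_mem' := by
    intro c x hx i hi
    simp [Pi.smul_apply, hx i hi]

noncomputable def webbModule (k : Type) [Field k] : PersMod k ↥{n : ℤ | n ≤ 0} where
  space t := ↥(webbSubmodule k t.1)
  addCommGroup := fun _ => inferInstance
  module := fun _ => inferInstance
  map s t h := Submodule.inclusion (by
    intro x hx
    have hx' : ∀ i : ℕ, (i : ℤ) < -s.1 → x i = 0 := hx
    intro i hi
    exact hx' i (lt_of_lt_of_le hi (neg_le_neg h)))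
  map_id t := LinearMap.ext fun x => rfl
  map_comp r s t h1 h2 := LinearMap.ext fun x => rfl

end Webb

section Decorated

/-- `decMem t x` : the real number `t` belongs to the interval described by the
decorated pair `x = ((p, εp), (q, εq))`, where the decoration `false` means `⁻`
and `true` means `⁺`. -/
def decMem (t : ℝ) (x : (EReal × Bool) × (EReal × Bool)) : Prop :=
  (x.1.1 < (t : EReal) ∨ (x.1.1 = (t : EReal) ∧ x.1.2 = false)) ∧
  ((t : EReal) < x.2.1 ∨ ((t : EReal) = x.2.1 ∧ x.2.2 = true))

/-- A valid decorated pair: the left coordinate is `p⁻`/`p⁺` for a real `p` or `−∞⁺`,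
the right coordinate is `q⁻`/`q⁺` for a real `q` or `+∞⁻`, and the corresponding
interval is nonempty (i.e. `p* < q*`). -/
def ValidDec (x : (EReal × Bool) × (EReal × Bool)) : Prop :=
  (x.1.1 = ⊥ → x.1.2 = true) ∧ x.1.1 ≠ ⊤ ∧ (x.2.1 = ⊤ → x.2.2 = false) ∧ x.2.1 ≠ ⊥ ∧
  {t : ℝ | decMem t x}.Nonempty

/-- The decorated pair `x` belongs to the rectangle `[a,b] × [c,d]`, i.e.
`[b,c] ⊆ ⟨p*,q*⟩ ⊆ (a,d)`. -/
def decInRect (x : (EReal × Bool) × (EReal × Bool)) (a : EReal) (b c : ℝ) (d : EReal) : Prop :=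
  (∀ t ∈ Set.Icc b c, decMem t x) ∧
  (∀ t : ℝ, decMem t x → a < (t : EReal) ∧ (t : EReal) < d)

/-- `Dgm` is (a labelling of) the decorated persistence diagram of `V`. -/
def IsDgmOf {k : Type} [Field k] (V : PersMod k ℝ) {ι : Type}
    (Dgm : ι → (EReal × Bool) × (EReal × Bool)) : Prop :=
  (∀ i, ValidDec (Dgm i)) ∧
  ∀ (a : EReal) (b c : ℝ) (d : EReal), a < (b : EReal) → b ≤ c → (c : EReal) < d →
    persMeasure V a b c d = ecard {i : ι // decInRect (Dgm i) a b c d}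

end Decorated

section RMeasure

/-- `[a,b] × [c,d]` is a (nondegenerate) rectangle contained in `D`. -/
def RectIn (D : Set (ℝ × ℝ)) (a b c d : ℝ) : Prop :=
  a < b ∧ c < d ∧ Set.Icc a b ×ˢ Set.Icc c d ⊆ D

/-- An r-measure on `D`: additivity under horizontal and vertical splitting. -/
def IsRMeasure (D : Set (ℝ × ℝ)) (μ : ℝ → ℝ → ℝ → ℝ → ℕ∞) : Prop :=
  (∀ a p b c d, a < p → p < b → RectIn D a b c d → μ a b c d = μ a p c d + μ p b c d) ∧
  (∀ a b c q d, c < q → q < d → RectIn D a b c d → μ a b c d = μ a b c q + μ a b q d)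

/-- Membership of a decorated point of the plane (`Bool` decoration: `true` = `⁺`,
`false` = `⁻`) in the closed rectangle `[a,b] × [c,d]`. -/
def dptMem (x : (ℝ × Bool) × (ℝ × Bool)) (a b c d : ℝ) : Prop :=
  a ≤ x.1.1 ∧ x.1.1 ≤ b ∧ c ≤ x.2.1 ∧ x.2.1 ≤ d ∧
  (x.1.1 = a → x.1.2 = true) ∧ (x.1.1 = b → x.1.2 = false) ∧
  (x.2.1 = c → x.2.2 = true) ∧ (x.2.1 = d → x.2.2 = false)

/-- The r-interior `D•` of `D`: decorated points contained in some rectangle of `D`. -/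
def rInt (D : Set (ℝ × ℝ)) : Set ((ℝ × Bool) × (ℝ × Bool)) :=
  {x | ∃ a b c d, RectIn D a b c d ∧ dptMem x a b c d}

/-- The number of decorated points, counted with multiplicity `m`, lying in the
rectangle `[a,b] × [c,d]`. -/
noncomputable def dcount (m : (ℝ × Bool) × (ℝ × Bool) → ℕ) (a b c d : ℝ) : ℕ∞ :=
  ecard (Σ x : {x : (ℝ × Bool) × (ℝ × Bool) // dptMem x a b c d}, Fin (m x.1))

end RMeasure

/-! ### From compatible bars to a decomposition -/

noncomputable def barMap {k : Type} [Field k] (W : PersMod k ℝ) {L : Type} (J : L → Set ℝ)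
    (x : L → ∀ t, W.space t) (t : ℝ) (l : L) :
    (PLift (t ∈ J l) → k) →ₗ[k] W.space t where
  toFun f := (if h : t ∈ J l then f ⟨h⟩ else 0) • x l t
  map_add' f g := by by_cases h : t ∈ J l <;> simp [h, add_smul]
  map_smul' c f := by by_cases h : t ∈ J l <;> simp [h, mul_smul]

lemma persIso_of_bars {k : Type} [Field k] (W : PersMod k ℝ) {L : Type} (J : L → Set ℝ)
    (hJ : ∀ l, IsIntervalSet (J l))
    (x : L → ∀ t, W.space t) (h0 : ∀ l t, t ∉ J l → x l t = 0)
    (hc : ∀ l s t (h : s ≤ t), s ∈ J l → W.map s t h (x l s) = x l t)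
    (hli : ∀ t, LinearIndepOn k (fun l => x l t) {l | t ∈ J l})
    (hsp : ∀ t, ⊤ ≤ Submodule.span k (Set.range fun l => x l t)) :
    PersIso W (dsum fun l => intervalModule k ℝ (J l) (hJ l)) := by
  let g : ∀ t, (dsum fun l => intervalModule k ℝ (J l) (hJ l)).space t →ₗ[k] W.space t :=
    fun t => DFinsupp.lsum ℕ (fun l => barMap W J x t l)
  have hgs : ∀ t l f, g t (DFinsupp.single l f) = barMap W J x t l f := by
    intro t l f
    exact DFinsupp.lsum_single (S := ℕ) (F := fun l => barMap W J x t l) l f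
  have hbij : ∀ t, Function.Bijective (g t) := by
    intro t
    constructor
    · rw [← LinearMap.ker_eq_bot, LinearMap.ker_eq_bot']
      intro (f : Π₀ l, (PLift (t ∈ J l) → k)) hf
      have hf' : ∑ l ∈ DFinsupp.support f, barMap W J x t l (f l) = 0 := by
        rw [← hf]
        exact (DFinsupp.sumAddHom_apply (fun l => (barMap W J x t l).toAddMonoidHom) f).symm
      have key := (linearIndepOn_iff'.1 (hli t)) (DFinsupp.support f)
        (fun l => if h : t ∈ J l then f l ⟨h⟩ else 0) (by
          intro l hl
          by_contra hn
          refine (DFinsupp.mem_support_iff.1 hl) ?_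
          funext h
          exact (hn h.down).elim) hf'
      refine DFinsupp.ext fun l => ?_
      by_contra hl
      have := key l (DFinsupp.mem_support_iff.2 hl)
      apply hl
      funext h
      rw [dif_pos h.down] at this
      exact this
    · rw [← LinearMap.range_eq_top, eq_top_iff]
      refine (hsp t).trans (Submodule.span_le.2 ?_)
      rintro _ ⟨l, rfl⟩
      by_cases h : t ∈ J l
      · refine ⟨DFinsupp.single l (fun _ => (1 : k)), ?_⟩
        refine (hgs t l _).trans ?_
        simp [barMap, h]
      · simp [h0 l t h]
  let e : ∀ t, (dsum fun l => intervalModule k ℝ (J l) (hJ l)).space t ≃ₗ[k] W.space t :=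
    fun t => LinearEquiv.ofBijective (g t) (hbij t)
  have hnat : ∀ s t (h : s ≤ t), (g t).comp
      ((dsum fun l => intervalModule k ℝ (J l) (hJ l)).map s t h) = (W.map s t h).comp (g s) := by
    intro s t h
    refine DFinsupp.lhom_ext fun l f => ?_
    have h1 : (dsum fun l => intervalModule k ℝ (J l) (hJ l)).map s t h (DFinsupp.single l f)
        = DFinsupp.single l ((intervalModule k ℝ (J l) (hJ l)).map s t h f) :=
      DFinsupp.mapRange_single (hf := fun i => map_zero _)
    refine ((congrArg (g t) h1).trans (hgs t l _)).trans
      (Eq.trans ?_ (congrArg (W.map s t h) (hgs s l f)).symm)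
    show (if ht : t ∈ J l then (if hs : s ∈ J l then f ⟨hs⟩ else 0) else 0) • x l t
      = W.map s t h ((if hs : s ∈ J l then f ⟨hs⟩ else 0) • x l s)
    rw [map_smul]
    by_cases hs : s ∈ J l
    · rw [hc l s t h hs]
      by_cases ht : t ∈ J l
      · simp [hs, ht]
      · simp [h0 l t ht]
    · simp [hs]
  refine ⟨fun t => (e t).symm, fun s t h => ?_⟩
  refine LinearMap.ext fun w => ?_
  obtain ⟨f, rfl⟩ := (e s).surjective w
  show (e t).symm (W.map s t h (g s f)) = (dsum fun l => intervalModule k ℝ (J l) (hJ l)).map s t h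
    ((e s).symm (e s f))
  rw [LinearEquiv.symm_apply_apply, LinearEquiv.symm_apply_eq]
  exact (LinearMap.congr_fun (hnat s t h) f).symm

/-! ### Sections, filtrations -/

lemma exists_rel_compl {k X : Type} [Field k] [AddCommGroup X] [Module k X]
    (K N : Submodule k X) : ∃ C : Submodule k X, C ≤ K ∧ Disjoint C N ∧ K ≤ C ⊔ N := by
  obtain ⟨D, hD⟩ := exists_isCompl (K ⊓ N)
  refine ⟨D ⊓ K, inf_le_right, ?_, ?_⟩
  · rw [disjoint_iff, inf_assoc, inf_comm]
    exact hD.disjoint.eq_bot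
  · intro x hx
    have hx' : x ∈ (K ⊓ N) ⊔ D := by rw [hD.codisjoint.eq_top]; trivial
    obtain ⟨y, hy, z, hz, rfl⟩ := Submodule.mem_sup.1 hx'
    have hzK : z ∈ K := by simpa using K.sub_mem hx hy.1
    exact Submodule.mem_sup.2 ⟨z, ⟨hz, hzK⟩, y, hy.2, add_comm _ _⟩

section Sections

variable {k : Type} [Field k] (W : PersMod k ℝ) (p : ℝ → ℤ)

/-- Compatible sections over `{t | a ≤ p t}`, extended by zero. -/
def secMod (a : WithBot ℤ) : Submodule k (∀ t, W.space t) where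
  carrier := {x | (∀ t, ¬ a ≤ ((p t : ℤ) : WithBot ℤ) → x t = 0) ∧
    ∀ s t (h : s ≤ t), a ≤ ((p s : ℤ) : WithBot ℤ) → W.map s t h (x s) = x t}
  add_mem' := by
    rintro x y ⟨hx, hx'⟩ ⟨hy, hy'⟩
    refine ⟨fun t ht => by simp [hx t ht, hy t ht], fun s t h ha => ?_⟩
    simp [hx' s t h ha, hy' s t h ha]
  zero_mem' := ⟨fun _ _ => rfl, fun s t h _ => by simp⟩
  smul_mem' := by
    rintro c x ⟨hx, hx'⟩
    refine ⟨fun t ht => by simp [hx t ht], fun s t h ha => ?_⟩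
    simp [hx' s t h ha]

/-- Families vanishing on `{t | d ≤ p t}`. -/
def vanMod (d : WithTop ℤ) : Submodule k (∀ t, W.space t) where
  carrier := {x | ∀ t, d ≤ ((p t : ℤ) : WithTop ℤ) → x t = 0}
  add_mem' := by
    intro x y hx hy t ht
    simp [hx t ht, hy t ht]
  zero_mem' := fun _ _ => rfl
  smul_mem' := by
    intro c x hx t ht
    simp [hx t ht]

noncomputable def truncMap (a : WithBot ℤ) : (∀ t, W.space t) →ₗ[k] (∀ t, W.space t) where
  toFun x := fun t => if a ≤ ((p t : ℤ) : WithBot ℤ) then x t else 0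
  map_add' x y := by
    funext t; by_cases h : a ≤ ((p t : ℤ) : WithBot ℤ) <;> simp [h]
  map_smul' c x := by
    funext t; by_cases h : a ≤ ((p t : ℤ) : WithBot ℤ) <;> simp [h]

noncomputable def oldMod (a : WithBot ℤ) : Submodule k (∀ t, W.space t) :=
  ⨆ a' : WithBot ℤ, ⨆ _ : a' < a, (secMod W p a').map (truncMap W p a)

noncomputable def kerMod (a : WithBot ℤ) (d : WithTop ℤ) : Submodule k (∀ t, W.space t) :=
  secMod W p a ⊓ vanMod W p d

noncomputable def kerPrev (a : WithBot ℤ) (d : WithTop ℤ) : Submodule k (∀ t, W.space t) :=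
  ⨆ d' : WithTop ℤ, ⨆ _ : d' < d, kerMod W p a d'

noncomputable def cMod (a : WithBot ℤ) (d : WithTop ℤ) : Submodule k (∀ t, W.space t) :=
  (exists_rel_compl (kerMod W p a d) (oldMod W p a ⊔ kerPrev W p a d)).choose

lemma cMod_le (a : WithBot ℤ) (d : WithTop ℤ) : cMod W p a d ≤ kerMod W p a d :=
  (exists_rel_compl (kerMod W p a d) (oldMod W p a ⊔ kerPrev W p a d)).choose_spec.1

lemma cMod_disj (a : WithBot ℤ) (d : WithTop ℤ) :
    Disjoint (cMod W p a d) (oldMod W p a ⊔ kerPrev W p a d) :=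
  (exists_rel_compl (kerMod W p a d) (oldMod W p a ⊔ kerPrev W p a d)).choose_spec.2.1

lemma le_cMod (a : WithBot ℤ) (d : WithTop ℤ) :
    kerMod W p a d ≤ cMod W p a d ⊔ (oldMod W p a ⊔ kerPrev W p a d) :=
  (exists_rel_compl (kerMod W p a d) (oldMod W p a ⊔ kerPrev W p a d)).choose_spec.2.2

abbrev BarIx : Type :=
  Σ ad : WithBot ℤ × WithTop ℤ, Module.Basis.ofVectorSpaceIndex k (cMod W p ad.1 ad.2)

noncomputable def barVec (l : BarIx W p) : ∀ t, W.space t :=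
  (Module.Basis.ofVectorSpace k (cMod W p l.1.1 l.1.2) l.2 : cMod W p l.1.1 l.1.2).1

def barSet (l : BarIx W p) : Set ℝ :=
  {t | l.1.1 ≤ ((p t : ℤ) : WithBot ℤ) ∧ ((p t : ℤ) : WithTop ℤ) < l.1.2}

lemma barVec_mem_c (l : BarIx W p) : barVec W p l ∈ cMod W p l.1.1 l.1.2 := Subtype.property _

lemma barVec_mem (l : BarIx W p) : barVec W p l ∈ kerMod W p l.1.1 l.1.2 :=
  cMod_le W p _ _ (barVec_mem_c W p l)

lemma barVec_zero (l : BarIx W p) (t : ℝ) (ht : t ∉ barSet W p l) : barVec W p l t = 0 := by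
  obtain ⟨h1, h2⟩ := barVec_mem W p l
  by_cases h : l.1.1 ≤ ((p t : ℤ) : WithBot ℤ)
  · refine h2 t ?_
    by_contra hn
    exact ht ⟨h, not_le.1 hn⟩
  · exact h1.1 t h

lemma barVec_map (l : BarIx W p) (s t : ℝ) (h : s ≤ t) (hs : s ∈ barSet W p l) :
    W.map s t h (barVec W p l s) = barVec W p l t :=
  (barVec_mem W p l).1.2 s t h hs.1

lemma barSet_interval (hp : Monotone p) (l : BarIx W p) : IsIntervalSet (barSet W p l) := by
  constructor
  · by_contra hn
    rw [Set.not_nonempty_iff_eq_empty] at hn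
    have : Module.Basis.ofVectorSpace k (cMod W p l.1.1 l.1.2) l.2 = 0 := by
      apply Subtype.ext
      funext t
      exact barVec_zero W p l t (by rw [hn]; simp)
    exact (Module.Basis.ofVectorSpace k (cMod W p l.1.1 l.1.2)).ne_zero l.2 this
  · rintro r s t ⟨hr, _⟩ ⟨_, ht⟩ hrs hst
    exact ⟨hr.trans (WithBot.coe_le_coe.2 (hp hrs)),
      lt_of_le_of_lt (WithTop.coe_le_coe.2 (hp hst)) ht⟩

lemma barVec_indep_key (ad : WithBot ℤ × WithTop ℤ) :
    LinearIndepOn k (barVec W p) {l | l.1 = ad} := by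
  have h := (Module.Basis.ofVectorSpace k (cMod W p ad.1 ad.2)).linearIndependent
  have h2 := h.map' (cMod W p ad.1 ad.2).subtype (Submodule.ker_subtype _)
  let f : {l : BarIx W p // l ∈ {l : BarIx W p | l.1 = ad}} →
    Module.Basis.ofVectorSpaceIndex k (cMod W p ad.1 ad.2) := fun l => by
      obtain ⟨⟨ad', i⟩, hl⟩ := l
      change ad' = ad at hl
      exact hl ▸ i
  have h3 := h2.comp f (by
    rintro ⟨⟨ad1, i⟩, h1⟩ ⟨⟨ad2, j⟩, h2⟩ hij
    change ad1 = ad at h1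
    change ad2 = ad at h2
    subst h1
    subst h2
    change i = j at hij
    rw [hij])
  have h4 : ((cMod W p ad.1 ad.2).subtype ∘ Module.Basis.ofVectorSpace k (cMod W p ad.1 ad.2)) ∘ f
      = fun l => barVec W p l.1 := by
    funext ⟨⟨ad1, i⟩, h1⟩
    change ad1 = ad at h1
    subst h1
    rfl
  rw [h4] at h3
  exact h3

lemma cMod_span (a : WithBot ℤ) (d : WithTop ℤ) :
    cMod W p a d ≤ Submodule.span k (Set.range (barVec W p)) := by
  intro x hx
  have h := (Module.Basis.ofVectorSpace k (cMod W p a d)).span_eq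
  have hx' : (⟨x, hx⟩ : cMod W p a d) ∈ Submodule.span k
      (Set.range (Module.Basis.ofVectorSpace k (cMod W p a d))) := by rw [h]; trivial
  have := Submodule.mem_map_of_mem (f := (cMod W p a d).subtype) hx'
  rw [Submodule.map_span] at this
  refine Submodule.span_mono ?_ this
  rintro _ ⟨_, ⟨i, rfl⟩, rfl⟩
  exact ⟨⟨(a, d), i⟩, rfl⟩

lemma trunc_sec {a : WithBot ℤ} {x : ∀ t, W.space t} (hx : x ∈ secMod W p a) :
    truncMap W p a x = x := by
  funext t
  by_cases h : a ≤ ((p t : ℤ) : WithBot ℤ)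
  · simp [truncMap, h]
  · simp [truncMap, h, hx.1 t h]

lemma trunc_mem (hp : Monotone p) {a a' : WithBot ℤ} (haa : a' ≤ a) {x : ∀ t, W.space t}
    (hx : x ∈ secMod W p a') : truncMap W p a x ∈ secMod W p a := by
  refine ⟨fun t ht => by simp [truncMap, ht], fun s t h hs => ?_⟩
  have ht : a ≤ ((p t : ℤ) : WithBot ℤ) := hs.trans (WithBot.coe_le_coe.2 (hp h))
  simp [truncMap, hs, ht, hx.2 s t h (haa.trans hs)]

lemma sec_vanish (hp : Monotone p)
    (hiso : ∀ s t (h : s ≤ t), p s = p t → Function.Bijective (W.map s t h))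
    {a : WithBot ℤ} {x : ∀ t, W.space t} (hx : x ∈ secMod W p a) (t : ℝ) (hxt : x t = 0) 
    (hat : a ≤ ((p t : ℤ) : WithBot ℤ)) :
    x ∈ vanMod W p ((p t : ℤ) : WithTop ℤ) := by
  intro s hs
  have hs : p t ≤ p s := WithTop.coe_le_coe.1 hs
  rcases le_total t s with h | h
  · rw [← hx.2 t s h hat, hxt, map_zero]
  · have e : p s = p t := le_antisymm (hp h) hs
    apply (hiso s t h e).1
    rw [hx.2 s t h (by rw [e]; exact hat), hxt, map_zero]

lemma bar_indep (hp : Monotone p)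
    (hiso : ∀ s t (h : s ≤ t), p s = p t → Function.Bijective (W.map s t h)) (t : ℝ) :
    LinearIndepOn k (fun l => barVec W p l t) {l | t ∈ barSet W p l} := by
  rw [linearIndepOn_iff']
  intro S g hS hsum
  by_contra hcon
  push Not at hcon
  obtain ⟨i, hi, hgi⟩ := hcon
  set S' := S.filter (fun l => g l ≠ 0) with hS'
  have hne : S'.Nonempty := ⟨i, by simp [hS', hi, hgi]⟩
  obtain ⟨l0, hl0, hmax⟩ := Finset.exists_max_image S' (fun l => toLex l.1) hne
  obtain ⟨⟨a, d⟩, i0⟩ := l0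
  have hl0S := (Finset.mem_filter.1 hl0).1
  have hl0g := (Finset.mem_filter.1 hl0).2
  have hl0J : t ∈ barSet W p ⟨(a, d), i0⟩ := hS hl0S
  have hsum' : ∑ l ∈ S', g l • barVec W p l t = 0 := by
    rw [← hsum]
    refine Finset.sum_filter_of_ne fun l _ h hg => h (by simp [hg])
  have hle : ∀ l ∈ S', l.1.1 < a ∨ (l.1.1 = a ∧ l.1.2 ≤ d) := by
    intro l hl
    have := hmax l hl
    exact (Prod.Lex.le_iff.1 this)
  set y : ∀ t, W.space t := truncMap W p a (∑ l ∈ S', g l • barVec W p l) with hy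
  have hyt : y t = 0 := by
    simp only [hy, truncMap, LinearMap.coe_mk, AddHom.coe_mk]
    rw [if_pos hl0J.1, Finset.sum_apply]
    exact hsum'
  have hyL : y ∈ secMod W p a := by
    rw [hy, map_sum]
    refine Submodule.sum_mem _ fun l hl => ?_
    rw [map_smul]
    refine Submodule.smul_mem _ _ (trunc_mem W p hp (a' := l.1.1) ?_ (barVec_mem W p l).1)
    rcases hle l hl with h | h
    · exact h.le
    · exact h.1.le
  have hyN : y ∈ oldMod W p a ⊔ kerPrev W p a d := by
    refine Submodule.mem_sup_right ?_
    refine Submodule.mem_iSup_of_mem ((p t : ℤ) : WithTop ℤ)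
      (Submodule.mem_iSup_of_mem hl0J.2 ?_)
    exact ⟨hyL, sec_vanish W p hp hiso hyL t hyt hl0J.1⟩
  have hother : ∀ l ∈ S'.filter (fun l => ¬ l.1 = (a, d)),
      truncMap W p a (g l • barVec W p l) ∈ oldMod W p a ⊔ kerPrev W p a d := by
    intro l hl
    obtain ⟨hl, hne⟩ := Finset.mem_filter.1 hl
    rw [map_smul]
    refine Submodule.smul_mem _ _ ?_
    rcases hle l hl with h | ⟨h1, h2⟩
    · refine Submodule.mem_sup_left (Submodule.mem_iSup_of_mem l.1.1
        (Submodule.mem_iSup_of_mem h ?_))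
      exact Submodule.mem_map_of_mem (barVec_mem W p l).1
    · have h3 : l.1.2 < d := lt_of_le_of_ne h2 (fun h => hne (Prod.ext h1 h))
      have hm := barVec_mem W p l
      rw [h1] at hm
      rw [trunc_sec W p hm.1]
      exact Submodule.mem_sup_right (Submodule.mem_iSup_of_mem l.1.2
        (Submodule.mem_iSup_of_mem h3 hm))
  set c : ∀ t, W.space t := ∑ l ∈ S'.filter (fun l => l.1 = (a, d)), g l • barVec W p l with hc
  have hcC : c ∈ cMod W p a d := by
    refine Submodule.sum_mem _ fun l hl => Submodule.smul_mem _ _ ?_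
    have hm := barVec_mem_c W p l
    rw [(Finset.mem_filter.1 hl).2] at hm
    exact hm
  have hcN : c ∈ oldMod W p a ⊔ kerPrev W p a d := by
    have e : y = c + ∑ l ∈ S'.filter (fun l => ¬ l.1 = (a, d)),
        truncMap W p a (g l • barVec W p l) := by
      rw [hy, ← Finset.sum_filter_add_sum_filter_not S' (fun l => l.1 = (a, d)), map_add,
        ← hc, trunc_sec W p (cMod_le W p _ _ hcC).1, map_sum]
    rw [e] at hyN
    exact (Submodule.add_mem_iff_left _ (Submodule.sum_mem _ hother)).1 hyN
  have hc0 : c = 0 := Submodule.disjoint_def.1 (cMod_disj W p a d) c hcC hcN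
  refine hl0g (linearIndepOn_iff'.1 (barVec_indep_key W p (a, d)) _ g ?_ hc0 ⟨(a, d), i0⟩ ?_)
  · intro l hl
    exact (Finset.mem_filter.1 hl).2
  · exact Finset.mem_filter.2 ⟨hl0, rfl⟩

lemma map_map_apply {r s t : ℝ} (h1 : r ≤ s) (h2 : s ≤ t) (v : W.space r) :
    W.map s t h2 (W.map r s h1 v) = W.map r t (h1.trans h2) v :=
  LinearMap.congr_fun (W.map_comp r s t h1 h2) v

lemma map_self_apply (t : ℝ) (h : t ≤ t) (v : W.space t) : W.map t t h v = v :=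
  LinearMap.congr_fun (W.map_id t) v

/-- Values at `t` of sections over `{a ≤ p}`. -/
noncomputable def valMod (a : WithBot ℤ) (t : ℝ) : Submodule k (W.space t) :=
  (secMod W p a).map (LinearMap.proj t)

lemma mem_valMod {a : WithBot ℤ} {t : ℝ} {w : W.space t} :
    w ∈ valMod W p a t ↔ ∃ x ∈ secMod W p a, x t = w := Iff.rfl

lemma valMod_mono (hp : Monotone p) {a a' : WithBot ℤ} (h : a' ≤ a) (t : ℝ)
    (ht : a ≤ ((p t : ℤ) : WithBot ℤ)) : valMod W p a' t ≤ valMod W p a t := by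
  rintro _ ⟨x, hx, rfl⟩
  exact ⟨truncMap W p a x, trunc_mem W p hp h hx, by simp [truncMap, ht]⟩

lemma valMod_stab (hp : Monotone p) (t : ℝ) (hfin : FiniteDimensional k (W.space t)) :
    ∃ a0 : ℤ, a0 ≤ p t ∧ ∀ a : ℤ, a ≤ a0 → valMod W p a t = valMod W p a0 t := by
  obtain ⟨_, ⟨a0, ha0, rfl⟩, hmin⟩ := (wellFounded_lt (α := Submodule k (W.space t))).has_min
    ((fun a : ℤ => valMod W p a t) '' {a | a ≤ p t}) ⟨_, p t, le_refl (p t), rfl⟩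
  refine ⟨a0, ha0, fun a ha => ?_⟩
  have h1 : valMod W p a t ≤ valMod W p a0 t :=
    valMod_mono W p hp (WithBot.coe_le_coe.2 ha) t (WithBot.coe_le_coe.2 ha0)
  by_contra hne
  exact hmin _ ⟨a, ha.trans ha0, rfl⟩ (lt_of_le_of_ne h1 hne)

lemma valMod_bot (hp : Monotone p) (hfin : ∀ t, FiniteDimensional k (W.space t)) (t : ℝ) :
    ∃ a0 : ℤ, a0 ≤ p t ∧ valMod W p a0 t ≤ valMod W p ⊥ t := by
  choose a0 ha0 hst using fun t => valMod_stab W p hp t (hfin t)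
  refine ⟨a0 t, ha0 t, ?_⟩
  intro w hw
  have hsurj : ∀ s t (h : s ≤ t) (w : W.space t), w ∈ valMod W p (a0 t) t →
      ∃ v : W.space s, v ∈ valMod W p (a0 s) s ∧ W.map s t h v = w := by
    intro s t h w hw
    rw [← hst t (min (a0 s) (a0 t)) (min_le_right _ _)] at hw
    obtain ⟨x, hx, rfl⟩ := hw
    refine ⟨x s, ?_, ?_⟩
    · rw [← hst s (min (a0 s) (a0 t)) (min_le_left _ _)]
      exact ⟨x, hx, rfl⟩
    · exact hx.2 s t h (WithBot.coe_le_coe.2 ((min_le_left _ _).trans (ha0 s)))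
  obtain ⟨τ, hτ0, hτ, hτb⟩ : ∃ τ : ℕ → ℝ, τ 0 = t ∧ Antitone τ ∧ ∀ s, ∃ j, τ j ≤ s := by
    refine ⟨fun j => t - j, by simp, fun i j hij => ?_, fun s => ?_⟩
    · have : (i : ℝ) ≤ j := by exact_mod_cast hij
      simp only; linarith
    · obtain ⟨j, hj⟩ := exists_nat_ge (t - s)
      exact ⟨j, by simp only; linarith⟩
  subst hτ0
  choose f hf1 hf2 using fun j => hsurj (τ (j + 1)) (τ j) (hτ (Nat.le_succ j))
  let v : ∀ j, {v : W.space (τ j) // v ∈ valMod W p (a0 (τ j)) (τ j)} := fun j =>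
    Nat.rec ⟨w, hw⟩ (fun j v => ⟨f j v.1 v.2, hf1 j v.1 v.2⟩) j
  have hv1 : ∀ j, W.map (τ (j + 1)) (τ j) (hτ (Nat.le_succ j)) (v (j + 1)).1 = (v j).1 :=
    fun j => hf2 j (v j).1 (v j).2
  have hv : ∀ i j (h : i ≤ j), W.map (τ j) (τ i) (hτ h) (v j).1 = (v i).1 := by
    intro i j h
    induction j, h using Nat.le_induction with
    | base => exact map_self_apply W _ _ _
    | succ j h ih =>
      rw [← ih, ← hv1 j, map_map_apply]
  choose J hJ using hτb
  have hx : ∀ s j (h : τ j ≤ s), W.map (τ j) s h (v j).1 = W.map (τ (J s)) s (hJ s) (v (J s)).1 := by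
    intro s j h
    rcases le_total j (J s) with h1 | h1
    · rw [← hv _ _ h1, map_map_apply]
    · rw [← hv _ _ h1, map_map_apply]
  refine ⟨fun s => W.map (τ (J s)) s (hJ s) (v (J s)).1, ⟨fun t ht => (ht bot_le).elim, ?_⟩, ?_⟩
  · intro s t h _
    simp only
    rw [map_map_apply, hx]
  · show W.map (τ (J (τ 0))) (τ 0) (hJ (τ 0)) (v (J (τ 0))).1 = w
    rw [← hx (τ 0) 0 le_rfl]
    exact map_self_apply W _ _ _

lemma valMod_top (hp : Monotone p)
    (hiso : ∀ s t (h : s ≤ t), p s = p t → Function.Bijective (W.map s t h)) (t : ℝ) 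
    (w : W.space t) : w ∈ valMod W p ((p t : ℤ) : WithBot ℤ) t := by
  have hex : ∀ s, ∃ u : W.space s, (∀ h : t ≤ s, W.map t s h w = u) ∧
      (∀ h : s ≤ t, p s = p t → W.map s t h u = w) ∧ (¬ p t ≤ p s → u = 0) := by
    intro s
    by_cases h : t ≤ s
    · refine ⟨W.map t s h w, fun _ => rfl, fun h' _ => ?_, fun hn => (hn (hp h)).elim⟩
      rw [map_map_apply, map_self_apply]
    · by_cases e : p s = p t
      · obtain ⟨u, hu⟩ := (hiso s t (not_le.1 h).le e).2 w
        exact ⟨u, fun h' => (h h').elim, fun _ _ => hu, fun hn => (hn e.ge).elim⟩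
      · exact ⟨0, fun h' => (h h').elim, fun _ h' => (e h').elim, fun _ => rfl⟩
  choose x hx1 hx2 hx3 using hex
  refine ⟨x, ⟨fun s hs => hx3 s (fun h => hs (WithBot.coe_le_coe.2 h)), fun r s h hr => ?_⟩, ?_⟩
  · have hr : p t ≤ p r := WithBot.coe_le_coe.1 hr
    rcases le_total t r with h1 | h1
    · rw [← hx1 r h1, ← hx1 s (h1.trans h), map_map_apply]
    · have er : p r = p t := le_antisymm (hp h1) hr
      rcases le_total t s with h2 | h2
      · rw [← hx1 s h2, ← hx2 r h1 er, map_map_apply]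
      · have es : p s = p t := le_antisymm (hp h2) (hr.trans (hp h))
        apply (hiso s t h2 es).1
        rw [hx2 s h2 es, map_map_apply, hx2 r h1 er]
  · show x t = w
    rw [← hx1 t le_rfl, map_self_apply]

lemma bar_span (hp : Monotone p)
    (hiso : ∀ s t (h : s ≤ t), p s = p t → Function.Bijective (W.map s t h))
    (hfin : ∀ t, FiniteDimensional k (W.space t)) (t : ℝ) :
    ⊤ ≤ Submodule.span k (Set.range fun l => barVec W p l t) := by
  set Sp := Submodule.span k (Set.range fun l => barVec W p l t) with hSp
  have hC : ∀ a d, cMod W p a d ≤ Sp.comap (LinearMap.proj t) := by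
    intro a d
    refine (cMod_span W p a d).trans (Submodule.span_le.2 ?_)
    rintro _ ⟨l, rfl⟩
    exact Submodule.subset_span ⟨l, rfl⟩
  have step : ∀ a : WithBot ℤ, (∀ a' < a, secMod W p a' ≤ Sp.comap (LinearMap.proj t)) →
      secMod W p a ≤ Sp.comap (LinearMap.proj t) := by
    intro a ih
    have hold : oldMod W p a ≤ Sp.comap (LinearMap.proj t) := by
      refine iSup_le fun a' => iSup_le fun ha' => ?_
      rintro _ ⟨x, hx, rfl⟩
      have := ih a' ha' hx
      simp only [Submodule.mem_comap, LinearMap.proj_apply] at this ⊢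
      by_cases h : a ≤ ((p t : ℤ) : WithBot ℤ)
      · simpa [truncMap, h] using this
      · simp [truncMap, h]
    have dstep : ∀ d : WithTop ℤ, (∀ d' < d, kerMod W p a d' ≤ Sp.comap (LinearMap.proj t)) →
        kerMod W p a d ≤ Sp.comap (LinearMap.proj t) := by
      intro d ihd
      refine (le_cMod W p a d).trans (sup_le (hC a d) (sup_le hold ?_))
      exact iSup_le fun d' => iSup_le fun hd' => ihd d' hd'
    have hint : ∀ m : ℤ, p t ≤ m → ∀ d : WithTop ℤ, d ≤ (m : WithTop ℤ) →
        kerMod W p a d ≤ Sp.comap (LinearMap.proj t) := by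
      intro m hm
      induction m, hm using Int.le_induction with
      | base =>
        intro d hd x hx
        simp only [Submodule.mem_comap, LinearMap.proj_apply]
        rw [hx.2 t hd]
        exact Sp.zero_mem
      | succ m hm ih =>
        intro d hd
        refine dstep d fun d' hd' => ih d' ?_
        have h1 := lt_of_lt_of_le hd' hd
        cases d' with
        | top => exact absurd h1 (by simp)
        | coe d' =>
          rw [WithTop.coe_lt_coe] at h1
          exact WithTop.coe_le_coe.2 (by omega)
    have htop : kerMod W p a ⊤ ≤ Sp.comap (LinearMap.proj t) := by
      refine dstep ⊤ fun d' hd' => ?_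
      cases d' with
      | top => exact absurd hd' (by simp)
      | coe d' =>
        exact hint (max d' (p t)) (le_max_right _ _) _ (WithTop.coe_le_coe.2 (le_max_left _ _))
    refine le_trans ?_ htop
    intro x hx
    refine ⟨hx, fun s hs => ?_⟩
    exact absurd hs (by simp)
  have hbot : secMod W p ⊥ ≤ Sp.comap (LinearMap.proj t) :=
    step ⊥ fun a' ha' => absurd ha' (by simp)
  obtain ⟨a0, ha0, hle⟩ := valMod_bot W p hp hfin t
  have hall : ∀ m : ℤ, a0 ≤ m → ∀ a : WithBot ℤ, a ≤ (m : WithBot ℤ) →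
      secMod W p a ≤ Sp.comap (LinearMap.proj t) := by
    intro m hm
    induction m, hm using Int.le_induction with
    | base =>
      intro a ha x hx
      have h1 : x t ∈ valMod W p a0 t :=
        valMod_mono W p hp ha t (WithBot.coe_le_coe.2 ha0) ⟨x, hx, rfl⟩
      obtain ⟨y, hy, hyx⟩ := hle h1
      have := hbot hy
      simp only [Submodule.mem_comap] at this ⊢
      rw [hyx] at this
      exact this
    | succ m hm ih =>
      intro a ha
      refine step a fun a' ha' => ih a' ?_
      have h1 := lt_of_lt_of_le ha' ha
      cases a' with
      | bot => exact bot_le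
      | coe a' =>
        rw [WithBot.coe_lt_coe] at h1
        exact WithBot.coe_le_coe.2 (by omega)
  intro w _
  obtain ⟨x, hx, rfl⟩ := valMod_top W p hp hiso t w
  exact hall (p t) ha0 _ le_rfl hx

end Sections

theorem locFinite_of_index {k : Type} [Field k] (W : PersMod k ℝ) (p : ℝ → ℤ) (hp : Monotone p)
    (hiso : ∀ s t (h : s ≤ t), p s = p t → Function.Bijective (W.map s t h))
    (hfin : ∀ t, FiniteDimensional k (W.space t)) : LocFinitePM k W := by
  refine ⟨BarIx W p, barSet W p, barSet_interval W p hp, ?_, ?_⟩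
  · exact persIso_of_bars W (barSet W p) (barSet_interval W p hp) (barVec W p)
      (barVec_zero W p) (barVec_map W p) (bar_indep W p hp hiso) (bar_span W p hp hiso hfin)
  · intro S hS
    have hfinbar : ∀ t, {l | t ∈ barSet W p l}.Finite := by
      intro t
      have := hfin t
      have h := bar_indep W p hp hiso t
      have : Finite {l | t ∈ barSet W p l} := h.finite
      exact Set.toFinite _
    obtain ⟨hb, ha⟩ := isBounded_iff_bddBelow_bddAbove.1 hS
    obtain ⟨α, hα⟩ := hb
    obtain ⟨β, hβ⟩ := ha
    have hU : (⋃ n ∈ Set.Icc (p α) (p β), {l | ∃ s, p s = n ∧ s ∈ barSet W p l}).Finite := by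
      refine Set.Finite.biUnion (Set.finite_Icc _ _) fun n _ => ?_
      by_cases h : ∃ t, p t = n
      · obtain ⟨t, rfl⟩ := h
        refine (hfinbar t).subset ?_
        rintro l ⟨s, hs, h1, h2⟩
        rw [hs] at h1 h2
        exact ⟨h1, h2⟩
      · refine Set.finite_empty.subset ?_
        rintro l ⟨s, hs, _⟩
        exact h ⟨s, hs⟩
    refine hU.subset ?_
    rintro l ⟨s, hsl, hsS⟩
    exact Set.mem_biUnion (x := p s) ⟨hp (hα hsS), hp (hβ hsS)⟩ ⟨s, rfl, hsl⟩

/-! ### The smoothing is constructible -/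

lemma exists_offset (c : ℤ → ℕ) : ∃ off : ℤ → ℤ, ∀ m, off (m + 1) = off m + c m + 1 := by
  refine ⟨fun m => ∑ i ∈ Finset.Ico 0 m, ((c i : ℤ) + 1) - ∑ i ∈ Finset.Ico m 0, ((c i : ℤ) + 1),
    fun m => ?_⟩
  simp only
  rcases le_or_gt 0 m with h | h
  · rw [Finset.Ico_eq_empty (a := m) (b := 0) (by omega),
      Finset.Ico_eq_empty (a := m + 1) (b := 0) (by omega)]
    have : Finset.Ico 0 (m + 1) = insert m (Finset.Ico 0 m) := by
      ext i; simp; omega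
    rw [this, Finset.sum_insert (by simp)]
    simp; ring
  · rw [Finset.Ico_eq_empty (a := 0) (b := m) (by omega),
      Finset.Ico_eq_empty (a := 0) (b := m + 1) (by omega)]
    have : Finset.Ico m 0 = insert m (Finset.Ico (m + 1) 0) := by
      ext i; simp; omega
    rw [this, Finset.sum_insert (by simp)]
    simp; ring

/-- Gluing local jump counters to a global one. -/
lemma exists_glue (fl : ℝ → ℤ) (hfl : Monotone fl) (φ : ℝ → ℕ) (c : ℤ → ℕ)
    (hc : ∀ s, φ s ≤ c (fl s)) (hφ : ∀ s t, s ≤ t → fl s = fl t → φ s ≤ φ t) :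
    ∃ p : ℝ → ℤ, Monotone p ∧ ∀ s t, s ≤ t → p s = p t → fl s = fl t ∧ φ s = φ t := by
  obtain ⟨off, hoff⟩ := exists_offset c
  have hmono : StrictMono off := strictMono_int_of_lt_succ fun m => by rw [hoff]; omega
  have hlt : ∀ s t, fl s < fl t → off (fl s) + φ s < off (fl t) + φ t := by
    intro s t h
    have h1 : off (fl s + 1) ≤ off (fl t) := hmono.monotone h
    have h2 := hoff (fl s)
    have h3 := hc s
    omega
  refine ⟨fun s => off (fl s) + φ s, fun s t h => ?_, fun s t h e => ?_⟩
  · rcases (hfl h).lt_or_eq with h1 | h1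
    · exact (hlt s t h1).le
    · have := hφ s t h h1
      simp only [h1]; omega
  · simp only at e
    rcases (hfl h).lt_or_eq with h1 | h1
    · exact absurd e (hlt s t h1).ne
    · rw [h1] at e
      exact ⟨h1, by omega⟩

lemma qtame_finite {k : Type} [Field k] {V : PersMod k ℝ} (hV : QTame k V) (s t : ℝ) (h : s < t) :
    FiniteDimensional k (LinearMap.range (V.map s t h.le)) := by
  have := hV s t h
  rw [erank, edim, Ne, Cardinal.toENat_eq_top, not_le] at this
  exact Module.rank_lt_aleph0_iff.1 this

section Smooth

variable {k : Type} [Field k] (V : PersMod k ℝ)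

/-- Image at `v` from `r` (if `r ≤ v`). -/
noncomputable def imAt (v r : ℝ) : Submodule k (V.space v) :=
  if h : r ≤ v then LinearMap.range (V.map r v h) else ⊤

/-- Kernel at `v` of the map to `r` (if `v ≤ r`). -/
noncomputable def keAt (v r : ℝ) : Submodule k (V.space v) :=
  if h : v ≤ r then LinearMap.ker (V.map v r h) else ⊥

lemma imAt_mono (v : ℝ) : Monotone (imAt V v) := by
  intro r s h
  by_cases hs : s ≤ v
  · simp only [imAt, hs, h.trans hs, dif_pos]
    rintro _ ⟨y, rfl⟩
    exact ⟨V.map r s h y, map_map_apply V _ _ _⟩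
  · simp [imAt, hs]

lemma keAt_mono (v : ℝ) : Monotone (keAt V v) := by
  intro r s h
  by_cases hr : v ≤ r
  · simp only [keAt, hr, hr.trans h, dif_pos]
    intro y hy
    rw [LinearMap.mem_ker] at hy ⊢
    rw [← map_map_apply V hr h, hy, map_zero]
  · simp [keAt, hr]

theorem smoothing_index (hV : QTame k V) (ε : ℝ) (hε : 0 < ε) :
    ∃ p : ℝ → ℤ, Monotone p ∧ ∀ s t (h : s ≤ t), p s = p t →
      Function.Bijective ((smoothing V ε hε).map s t h) := by
  let fl : ℝ → ℤ := fun s => ⌊s / ε⌋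
  have hfl : Monotone fl := fun s t h => Int.floor_le_floor (by gcongr)
  -- the point over a cell and the ambient finite dimensional space
  let v : ℤ → ℝ := fun m => (m : ℝ) * ε + ε
  let F : ∀ m : ℤ, Submodule k (V.space (v m)) := fun m => imAt V (v m) ((m : ℝ) * ε)
  have hFfin : ∀ m, FiniteDimensional k (F m) := by
    intro m
    have h : (m : ℝ) * ε < v m := by simp only [v]; linarith
    have := qtame_finite hV _ _ h
    have e : F m = LinearMap.range (V.map ((m : ℝ) * ε) (v m) h.le) := dif_pos h.le
    rw [e]
    exact this
  have hcell : ∀ s, s - ε ≤ (fl s : ℝ) * ε ∧ v (fl s) ≤ s + ε := by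
    intro s
    have h1 := Int.floor_le (s / ε)
    have h2 := Int.lt_floor_add_one (s / ε)
    rw [le_div_iff₀ hε] at h1
    rw [div_lt_iff₀ hε] at h2
    constructor
    · simp only [fl]; nlinarith
    · simp only [v, fl]; nlinarith
  let A : ∀ (m : ℤ) (s : ℝ), Submodule k (V.space (v m)) := fun m s => imAt V (v m) (s - ε) ⊓ F m
  let K : ∀ (m : ℤ) (s : ℝ), Submodule k (V.space (v m)) := fun m s => keAt V (v m) (s + ε) ⊓ F m
  have hAm : ∀ m, Monotone (A m) := fun m s t h =>
    inf_le_inf_right _ (imAt_mono V _ (by linarith))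
  have hKm : ∀ m, Monotone (K m) := fun m s t h =>
    inf_le_inf_right _ (keAt_mono V _ (by linarith))
  have hAf : ∀ m s, FiniteDimensional k (A m s) := fun m s =>
    Submodule.finiteDimensional_of_le (inf_le_right : A m s ≤ F m)
  have hKf : ∀ m s, FiniteDimensional k (K m s) := fun m s =>
    Submodule.finiteDimensional_of_le (inf_le_right : K m s ≤ F m)
  let ψ : ℤ → ℝ → ℕ := fun m s => Module.finrank k (A m s) + Module.finrank k (K m s)
  have hψ : ∀ m s t, s ≤ t → ψ m s ≤ ψ m t := fun m s t h =>
    add_le_add (Submodule.finrank_mono (hAm m h)) (Submodule.finrank_mono (hKm m h))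
  obtain ⟨p, hp, hpp⟩ := exists_glue fl hfl (fun s => ψ (fl s) s)
    (fun m => Module.finrank k (F m) + Module.finrank k (F m))
    (fun s => add_le_add (Submodule.finrank_mono inf_le_right)
      (Submodule.finrank_mono inf_le_right))
    (fun s t h e => by simp only [e]; exact hψ _ s t h)
  refine ⟨p, hp, fun s t h e => ?_⟩
  obtain ⟨e1, e2⟩ := hpp s t h e
  simp only [← e1] at e2
  obtain ⟨hs1, hs2⟩ := hcell s
  obtain ⟨ht1, ht2⟩ := hcell t
  rw [← e1] at ht1 ht2
  set m := fl s with hm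
  have hmv : (m : ℝ) * ε ≤ v m := by simp only [v]; linarith
  have i1 := Submodule.finrank_mono (hAm m h)
  have i2 := Submodule.finrank_mono (hKm m h)
  have e2' : Module.finrank k (A m s) + Module.finrank k (K m s) =
    Module.finrank k (A m t) + Module.finrank k (K m t) := e2
  have eA : A m s = A m t := Submodule.eq_of_le_of_finrank_eq (hAm m h) (by omega)
  have eK : K m s = K m t := Submodule.eq_of_le_of_finrank_eq (hKm m h) (by omega)
  have hst : s + ε ≤ t + ε := by linarith
  have hA : ∀ r, r - ε ≤ (m : ℝ) * ε → A m r = imAt V (v m) (r - ε) := fun r hr =>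
    inf_eq_left.2 (imAt_mono V _ hr)
  constructor
  · rw [← LinearMap.ker_eq_bot, LinearMap.ker_eq_bot']
    rintro ⟨_, ⟨y, rfl⟩⟩ hw
    have hw' : V.map (s + ε) (t + ε) hst (V.map (s - ε) (s + ε) (by linarith) y) = 0 :=
      congrArg Subtype.val hw
    apply Subtype.ext
    show V.map (s - ε) (s + ε) (by linarith) y = 0
    have hsv : s - ε ≤ v m := hs1.trans hmv
    rw [← map_map_apply V hsv hs2] at hw' ⊢
    rw [map_map_apply] at hw'
    have hb : V.map (s - ε) (v m) hsv y ∈ K m t := by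
      constructor
      · simp only [keAt, ht2, dif_pos]
        exact hw'
      · have : V.map (s - ε) (v m) hsv y ∈ A m s := by
          rw [hA s hs1]
          simp only [imAt, hsv, dif_pos]
          exact ⟨y, rfl⟩
        exact this.2
    rw [← eK] at hb
    have := hb.1
    simp only [keAt, hs2, dif_pos] at this
    exact this
  · rintro ⟨_, ⟨y, rfl⟩⟩
    have htv : t - ε ≤ v m := ht1.trans hmv
    have hsv : s - ε ≤ v m := hs1.trans hmv
    have hb : V.map (t - ε) (v m) htv y ∈ A m t := by
      rw [hA t ht1]
      simp only [imAt, htv, dif_pos]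
      exact ⟨y, rfl⟩
    rw [← eA, hA s hs1] at hb
    simp only [imAt, hsv, dif_pos] at hb
    obtain ⟨z, hz⟩ := hb
    refine ⟨⟨V.map (s - ε) (s + ε) (by linarith) z, ⟨z, rfl⟩⟩, ?_⟩
    apply Subtype.ext
    show V.map (s + ε) (t + ε) hst (V.map (s - ε) (s + ε) (by linarith) z) =
      V.map (t - ε) (t + ε) (by linarith) y
    rw [map_map_apply, ← map_map_apply V htv ht2, ← hz, map_map_apply]

end Smooth

theorem stmt19 {k : Type} [Field k] (V : PersMod k ℝ) (hV : QTame k V) (ε : ℝ) (hε : 0 < ε) :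
    LocFinitePM k (smoothing V ε hε) := by
  obtain ⟨p, hp, hiso⟩ := smoothing_index V hV ε hε
  exact locFinite_of_index _ p hp hiso fun t =>
    qtame_finite hV (t - ε) (t + ε) (by linarith)
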